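/- arXiv:2007.15483 — 12 statements merged into one kernel-verified Lean document; each statement's English description precedes it below -/
import Mathlib

section
/- Let f : ℚ → ℚ be given by f(z) = 1/z³. A nonzero rational number z is preperiodic for f (i.e., there exist natural numbers m < n with f^[m](z) = f^[n](z)) if and only if z = 1 or z = −1. (Together with the 2-cycle {0,∞}, this gives the complete ℚ-rational preperiodic graph of the unique conjugacy class in A₃(C₄) = A₃(D₄).) -/
theorem iterate_one_div_cube {K : Type*} [Field K] (z : K) (k : ℕ) :
    (fun w : K => 1 / w ^ 3)^[k] z = z ^ ((-3 : ℤ) ^ k) := by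
  induction k with
  | zero => simp
  | succ k ih =>
    rw [Function.iterate_succ_apply', ih, pow_succ (-3 : ℤ), zpow_mul, zpow_neg, one_div]
    norm_cast

/-- For `f(z) = 1/z³`, a nonzero rational `z` is preperiodic (there exist `m < n`
with `f^[m] z = f^[n] z`) if and only if `z = 1` or `z = -1`. -/
theorem A3C4_preperiodic_iff (z : ℚ) (hz : z ≠ 0) :
    (∃ m n : ℕ, m < n ∧
        (fun w : ℚ => 1 / w ^ 3)^[m] z = (fun w : ℚ => 1 / w ^ 3)^[n] z) ↔
      z = 1 ∨ z = -1 := by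
  constructor
  · rintro ⟨m, n, hmn, h⟩
    rw [iterate_one_div_cube, iterate_one_div_cube] at h
    have habs := congrArg abs h
    rw [abs_zpow, abs_zpow] at habs
    refine eq_or_eq_neg_of_abs_eq ?_
    by_contra hne
    have hpow := congrArg Int.natAbs ((zpow_right_inj₀ (abs_pos.mpr hz) hne).mp habs)
    rw [Int.natAbs_pow, Int.natAbs_pow] at hpow
    exact hmn.ne (Nat.pow_right_injective (by norm_num) hpow)
  · rintro (rfl | rfl) <;> exact ⟨0, 1, Nat.zero_lt_one, by norm_num⟩
end

section
/- Let f : ℚ → ℚ be given by f(z) = (z³ − 3)/(−3z²). No nonzero rational number is preperiodic for f: for every z ∈ ℚ with z ≠ 0 and all natural numbers m < n, f^[n](z) ≠ f^[m](z). (Hence the only ℚ-rational preperiodic points of the representative of A₃(𝔄₄) on P¹ are 0 and ∞.) -/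
/-- No rational number has cube `3`, by comparing `3`-adic valuations. -/
lemma cube_sub_three_ne_zero (w : ℚ) : w ^ 3 - 3 ≠ 0 := by
  intro h
  have hv : padicValRat 3 (w ^ 3) = padicValRat 3 (3 : ℕ) := by
    rw [sub_eq_zero.mp h]; rfl
  rw [padicValRat.pow, padicValRat.self (by norm_num)] at hv
  push_cast at hv
  omega

/-- The map `w ↦ (w³ − 3)/(−3w²)` strictly decreases the `3`-adic valuation. -/
lemma padicValRat_three_map_lt {w : ℚ} (hw : w ≠ 0) :
    padicValRat 3 ((w ^ 3 - 3) / (-3 * w ^ 2)) < padicValRat 3 w := by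
  have h_three : padicValRat 3 (-3 : ℚ) = 1 := by
    rw [padicValRat.neg]
    exact padicValRat.self (p := 3) (by norm_num)
  have h_cube : padicValRat 3 (w ^ 3) = 3 * padicValRat 3 w := by
    rw [padicValRat.pow]; norm_num
  have h_num : padicValRat 3 (w ^ 3 - 3) = min (3 * padicValRat 3 w) 1 := by
    have h := padicValRat.add_eq_min (p := 3) (q := w ^ 3) (r := -3)
      (by simpa [sub_eq_add_neg] using cube_sub_three_ne_zero w) (pow_ne_zero 3 hw)
      (by norm_num) (by rw [h_cube, h_three]; omega)
    rwa [h_cube, h_three, ← sub_eq_add_neg] at h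
  rw [padicValRat.div (cube_sub_three_ne_zero w)
      (mul_ne_zero (by norm_num) (pow_ne_zero 2 hw)),
    padicValRat.mul (by norm_num) (pow_ne_zero 2 hw), h_num, h_three, padicValRat.pow]
  push_cast
  omega

/-- For `f(z) = (z³ − 3)/(−3z²)`, no nonzero rational number is preperiodic:
for every `z ≠ 0` and all `m < n`, `f^[n] z ≠ f^[m] z`. -/
theorem A3A4_no_rational_preperiodic (z : ℚ) (hz : z ≠ 0) (m n : ℕ) (hmn : m < n) :
    (fun w : ℚ => (w ^ 3 - 3) / (-3 * w ^ 2))^[n] z ≠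
      (fun w : ℚ => (w ^ 3 - 3) / (-3 * w ^ 2))^[m] z := by
  set f : ℚ → ℚ := fun w => (w ^ 3 - 3) / (-3 * w ^ 2)
  have h_ne : ∀ k, f^[k] z ≠ 0 := by
    intro k
    induction k with
    | zero => exact hz
    | succ k ih =>
      rw [Function.iterate_succ_apply']
      exact div_ne_zero (cube_sub_three_ne_zero _)
        (mul_ne_zero (by norm_num) (pow_ne_zero 2 ih))
  have h_anti : StrictAnti fun k => padicValRat 3 (f^[k] z) := by
    refine strictAnti_nat_of_succ_lt fun k => ?_
    rw [Function.iterate_succ_apply']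
    exact padicValRat_three_map_lt (h_ne k)
  intro h
  exact (h_anti hmn).ne (congrArg (padicValRat 3) h)
end

section
/- Let f : ℚ → ℚ be given by f(z) = 1/z⁴. A nonzero rational number z is preperiodic for f (i.e., there exist natural numbers m < n with f^[m](z) = f^[n](z)) if and only if z = 1 or z = −1. (Together with the 2-cycle {0,∞}, this gives the complete ℚ-rational preperiodic graph of the unique conjugacy class in A₄(C₅) = A₄(D₅).) -/
theorem iterate_one_div_pow_four {K : Type*} [DivisionRing K] (z : K) (k : ℕ) :
    (fun w : K => 1 / w ^ 4)^[k] z = z ^ ((-4 : ℤ) ^ k) := by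
  induction k with
  | zero => simp
  | succ k ih =>
    rw [Function.iterate_succ_apply', ih, pow_succ (-4 : ℤ), zpow_mul, zpow_neg, one_div]
    norm_cast

/-- For `f(z) = 1/z⁴`, a nonzero rational `z` is preperiodic (there exist `m < n`
with `f^[m] z = f^[n] z`) if and only if `z = 1` or `z = -1`. -/
theorem A4C5_preperiodic_iff (z : ℚ) (hz : z ≠ 0) :
    (∃ m n : ℕ, m < n ∧
        (fun w : ℚ => 1 / w ^ 4)^[m] z = (fun w : ℚ => 1 / w ^ 4)^[n] z) ↔
      z = 1 ∨ z = -1 := by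
  constructor
  · rintro ⟨m, n, hmn, h⟩
    rw [iterate_one_div_pow_four, iterate_one_div_pow_four] at h
    by_contra hne
    have habs : |z| ≠ 1 := fun h1 => hne (eq_or_eq_neg_of_abs_eq h1)
    have hexp : (-4 : ℤ) ^ m = (-4) ^ n := by
      apply zpow_right_injective₀ (abs_pos.mpr hz) habs
      simpa only [abs_zpow] using congrArg abs h
    have hnat : 4 ^ m = 4 ^ n := by
      simpa [Int.natAbs_pow] using congrArg Int.natAbs hexp
    exact hmn.ne (Nat.pow_right_injective (by norm_num) hnat)
  · rintro (rfl | rfl) <;> exact ⟨1, 2, by norm_num, by norm_num⟩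
end

section
/- For all rational numbers x and y: if x² + (1 + y²)·x + 1 = 0 then x = −1 and y² = 1; and if x² − (1 + y²)·x + 1 = 0 then x = 1 and y² = 1. (Substituting x = t², y = l², this shows that for the family f_k(z) = (z⁴ + 1)/(k·z³) the only ℚ-rational fixed point that can occur together with a 2-cycle having ℚ-rational points is ∞, except for the degenerate collapse at k = 2.) -/
/-- If `s² A = t² B` with `A = 4r² + u²`, `B = r² + u²`, and both `(s, t)` and `(r, u)` are coprime,
then `B = s²` and `A = t²`. -/
lemma eq_sq_of_sq_mul_eq_sq_mul {r u s t : ℤ} (hst : IsCoprime s t) (hru : IsCoprime r u)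
    (hs : s ≠ 0) (h : s ^ 2 * (4 * r ^ 2 + u ^ 2) = t ^ 2 * (r ^ 2 + u ^ 2)) :
    r ^ 2 + u ^ 2 = s ^ 2 ∧ 4 * r ^ 2 + u ^ 2 = t ^ 2 := by
  have hst2 : IsCoprime (s ^ 2) (t ^ 2) := hst.pow
  obtain ⟨k, hk⟩ : s ^ 2 ∣ r ^ 2 + u ^ 2 := hst2.dvd_of_dvd_mul_left ⟨_, h.symm⟩
  have hk' : 4 * r ^ 2 + u ^ 2 = t ^ 2 * k := by
    have : s ^ 2 * (4 * r ^ 2 + u ^ 2) = s ^ 2 * (t ^ 2 * k) := by rw [h, hk]; ring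
    exact mul_left_cancel₀ (pow_ne_zero 2 hs) this
  have hdr : k ∣ 3 * r ^ 2 := ⟨t ^ 2 - s ^ 2, by linear_combination hk' - hk⟩
  have hdu : k ∣ 3 * u ^ 2 := ⟨4 * s ^ 2 - t ^ 2, by linear_combination 4 * hk - hk'⟩
  have hd3 : k ∣ 3 := by
    obtain ⟨c, d, hcd⟩ : IsCoprime (r ^ 2) (u ^ 2) := hru.pow
    have : (3 : ℤ) = c * (3 * r ^ 2) + d * (3 * u ^ 2) := by linear_combination -3 * hcd
    rw [this]
    exact dvd_add (hdr.mul_left _) (hdu.mul_left _)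
  have hpos : 0 < r ^ 2 + u ^ 2 := by
    rcases hru.ne_zero_or_ne_zero with h0 | h0 <;> positivity
  have hkpos : 0 < k := by
    by_contra hneg
    nlinarith [sq_nonneg s]
  have hk3 : k ≠ 3 := by
    rintro rfl
    have h3 : (3 : ℤ) ∣ r ∧ (3 : ℤ) ∣ u := by
      have hmod : (r ^ 2 + u ^ 2) % 3 = 0 := by omega
      have hr : r % 3 = 0 ∨ r % 3 = 1 ∨ r % 3 = 2 := by omega
      have hu : u % 3 = 0 ∨ u % 3 = 1 ∨ u % 3 = 2 := by omega
      rcases hr with hr | hr | hr <;> rcases hu with hu | hu | hu <;>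
        simp [pow_two, Int.add_emod, Int.mul_emod, hr, hu] at hmod
      omega
    have := hru.isUnit_of_dvd' h3.1 h3.2
    norm_num [Int.isUnit_iff] at this
  have hk1 : k = 1 := by
    have := Int.le_of_dvd (by norm_num) hd3
    interval_cases k <;> omega
  subst hk1
  exact ⟨by linarith, by linarith⟩

/-- From `2v · w = 2pq` and `(2v)² − w² = p² − q²` one obtains a smaller pair `(r, u)` for which
`r² + u²` and `4r² + u²` are both squares. -/
lemma exists_concordant_of_mul_eq {v w p q : ℤ} (hvw : IsCoprime (2 * v) w)
    (hpq0 : p * q ≠ 0) (hmul : v * w = p * q) (hsq : (2 * v) ^ 2 - w ^ 2 = p ^ 2 - q ^ 2) :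
    ∃ r u s t : ℤ, IsCoprime r u ∧ u % 2 = 1 ∧ r ≠ 0 ∧ r ^ 2 + u ^ 2 = s ^ 2 ∧
      4 * r ^ 2 + u ^ 2 = t ^ 2 ∧ r ∣ p * q := by
  obtain ⟨r, s, ⟨t, rfl⟩, ⟨u, rfl⟩, rfl⟩ := exists_dvd_and_dvd_of_dvd_mul (Dvd.intro w hmul)
  have hr : r ≠ 0 := by rintro rfl; simp at hpq0
  have hs : s ≠ 0 := by rintro rfl; simp at hpq0
  obtain rfl : w = t * u :=
    mul_left_cancel₀ (mul_ne_zero hr hs) (by linear_combination hmul)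
  have h2 : IsCoprime (2 : ℤ) u := hvw.of_mul_left_left.of_mul_right_right
  have hru : IsCoprime r u := hvw.of_mul_left_right.of_mul_left_left.of_mul_right_right
  have hst : IsCoprime s t := hvw.of_mul_left_right.of_mul_left_right.of_mul_right_left
  obtain ⟨hB, hA⟩ := eq_sq_of_sq_mul_eq_sq_mul hst hru hs (by linear_combination hsq)
  refine ⟨r, u, s, t, hru, ?_, hr, hB, hA, ⟨t * (s * u), by ring⟩⟩
  obtain ⟨c, d, hcd⟩ := h2
  rcases Int.emod_two_eq_zero_or_one u with hu | hu
  · obtain ⟨e, rfl⟩ := Int.dvd_of_emod_eq_zero hu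
    have : 2 * (c + d * e) = 1 := by linear_combination hcd
    omega
  · exact hu

/-- The symmetric form of `exists_concordant_of_mul_eq`, with the even factor unspecified. -/
lemma exists_concordant {v w p q : ℤ} (hvw : IsCoprime v w)
    (hpq0 : p * q ≠ 0) (hmul : v * w = 2 * (p * q)) (hsq : v ^ 2 - w ^ 2 = p ^ 2 - q ^ 2) :
    ∃ r u s t : ℤ, IsCoprime r u ∧ u % 2 = 1 ∧ r ≠ 0 ∧ r ^ 2 + u ^ 2 = s ^ 2 ∧
      4 * r ^ 2 + u ^ 2 = t ^ 2 ∧ r ∣ p * q := by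
  rcases Int.prime_two.dvd_mul.1 (Dvd.intro _ hmul.symm) with ⟨v, rfl⟩ | ⟨w, rfl⟩
  · exact exists_concordant_of_mul_eq hvw hpq0 (by linarith) hsq
  · rw [mul_comm p q] at hpq0 ⊢
    exact exists_concordant_of_mul_eq hvw.symm hpq0 (by linarith) (by linarith)

/-- A primitive Pythagorean triple with odd first leg and even second leg, parametrized. -/
lemma exists_param_of_sq_add_sq {x y z : ℤ} (h : x ^ 2 + y ^ 2 = z ^ 2) (hxy : IsCoprime x y)
    (hx : x % 2 = 1) : ∃ m n : ℤ, x = m ^ 2 - n ^ 2 ∧ y = 2 * m * n ∧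
      IsCoprime m n ∧ (m * n) % 2 = 0 := by
  have hx0 : x ≠ 0 := by rintro rfl; simp at hx
  have hz : 0 < |z| := by
    rw [abs_pos]
    rintro rfl
    have : 0 < x ^ 2 := by positivity
    nlinarith [sq_nonneg y]
  have hP : PythagoreanTriple x y |z| := by
    have := sq_abs z
    unfold PythagoreanTriple
    linarith
  obtain ⟨m, n, h₁, h₂, -, hmn, hpar, -⟩ :=
    hP.coprime_classification' (Int.isCoprime_iff_gcd_eq_one.1 hxy) hx hz
  refine ⟨m, n, h₁, h₂, Int.isCoprime_iff_gcd_eq_one.2 hmn, ?_⟩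
  rcases hpar with ⟨h0, -⟩ | ⟨-, h0⟩ <;> simp [Int.mul_emod, h0]

/-- `r² + u²` and `4r² + u²` cannot both be squares for coprime `r, u` with `r ≠ 0` and `u` odd. -/
lemma eq_zero_of_concordant {r u s t : ℤ} (hru : IsCoprime r u) (hu : u % 2 = 1)
    (h₁ : r ^ 2 + u ^ 2 = s ^ 2) (h₂ : 4 * r ^ 2 + u ^ 2 = t ^ 2) : r = 0 := by
  induction hN : r.natAbs using Nat.strong_induction_on generalizing r u s t with
  | _ N ih =>
    by_contra hr
    obtain ⟨p, q, hu₁, hr₁, -, -⟩ :=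
      exists_param_of_sq_add_sq (x := u) (y := r) (z := s) (by linarith) hru.symm hu
    have hu2 : IsCoprime u 2 := ⟨1, -(u / 2), by omega⟩
    obtain ⟨v, w, hu₂, hr₂, hvw, -⟩ :=
      exists_param_of_sq_add_sq (x := u) (y := 2 * r) (z := t) (by linarith)
        (hu2.mul_right hru.symm) hu
    have hr₃ : r = 2 * (p * q) := by linarith
    have hpq0 : p * q ≠ 0 := by
      intro h0
      exact hr (by rw [hr₃, h0, mul_zero])
    obtain ⟨r', u', s', t', hc, ho, hr0, hB, hA, hd⟩ :=
      exists_concordant hvw hpq0 (by linarith) (hu₂.symm.trans hu₁)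
    have hle := Nat.le_of_dvd (Int.natAbs_pos.2 hpq0) (Int.natAbs_dvd_natAbs.2 hd)
    exact hr0 (ih r'.natAbs (by omega) hc ho hB hA rfl)

lemma isCoprime_sq_sub_sq_mul {a b : ℤ} (h : IsCoprime a b) :
    IsCoprime (a ^ 2 - b ^ 2) (a * b) := by
  refine IsCoprime.mul_right ?_ ?_
  · have : IsCoprime (-b ^ 2 + a * a) a := by
      rw [IsCoprime.add_mul_left_left_iff]
      exact (h.symm.pow_left).neg_left
    convert this using 1; ring
  · have : IsCoprime (a ^ 2 + b * (-b)) b := by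
      rw [IsCoprime.add_mul_left_left_iff]
      exact h.pow_left
    convert this using 1; ring

/-- If `a⁴ − a²b² + b⁴` is a square with `a, b` coprime and `ab` even, then `ab = 0`. -/
lemma mul_eq_zero_of_quartic_of_even {a b c : ℤ} (hab : IsCoprime a b) (he : (a * b) % 2 = 0)
    (h : a ^ 4 - a ^ 2 * b ^ 2 + b ^ 4 = c ^ 2) : a * b = 0 := by
  have hc := isCoprime_sq_sub_sq_mul hab
  have ho : (a ^ 2 - b ^ 2) % 2 = 1 := by
    rcases Int.emod_two_eq_zero_or_one (a ^ 2 - b ^ 2) with h0 | h0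
    · have := hc.isUnit_of_dvd' (Int.dvd_of_emod_eq_zero h0) (Int.dvd_of_emod_eq_zero he)
      norm_num [Int.isUnit_iff] at this
    · exact h0
  obtain ⟨m, n, h₁, h₂, -, -⟩ :=
    exists_param_of_sq_add_sq (z := c) (by linear_combination h) hc ho
  by_contra h0
  have hmn : m * n ≠ 0 := by
    intro hmn
    exact h0 (by rw [h₂, mul_assoc, hmn, mul_zero])
  obtain ⟨r, u, s, t, hru, hu, hr, hB, hA, -⟩ :=
    exists_concordant hab hmn (by linarith) h₁
  exact hr (eq_zero_of_concordant hru hu hB hA)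

/-- If `a⁴ − a²b² + b⁴` is a square with `a, b` coprime and nonzero, then `a² = b²`. -/
lemma sq_eq_sq_of_quartic {a b c : ℤ} (hab : IsCoprime a b) (h0 : a * b ≠ 0)
    (h : a ^ 4 - a ^ 2 * b ^ 2 + b ^ 4 = c ^ 2) : a ^ 2 = b ^ 2 := by
  rcases Int.emod_two_eq_zero_or_one (a * b) with he | ho
  · exact absurd (mul_eq_zero_of_quartic_of_even hab he h) h0
  obtain ⟨m, n, h₁, h₂, hmn, hpar⟩ :=
    exists_param_of_sq_add_sq (z := c) (by linear_combination h)
      (isCoprime_sq_sub_sq_mul hab).symm ho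
  obtain ⟨d, hd⟩ : ∃ d, a ^ 2 + b ^ 2 = 2 * d := ⟨m * n + b ^ 2, by linear_combination h₂⟩
  have hquart : m ^ 4 - m ^ 2 * n ^ 2 + n ^ 4 = d ^ 2 := by
    have : 4 * (m ^ 4 - m ^ 2 * n ^ 2 + n ^ 4) = 4 * d ^ 2 := by
      linear_combination (-4 * (a * b + m ^ 2 - n ^ 2)) * h₁ -
        (a ^ 2 - b ^ 2 + 2 * m * n) * h₂ + (a ^ 2 + b ^ 2 + 2 * d) * hd
    linarith
  have := mul_eq_zero_of_quartic_of_even hmn hpar hquart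
  linear_combination h₂ + 2 * this

/-- The affine rational points of `x² − (1 + y²)x + 1 = 0` all have `x = 1`. -/
lemma eq_one_of_sq_sub_eq_zero {x y : ℚ} (h : x ^ 2 - (1 + y ^ 2) * x + 1 = 0) : x = 1 := by
  have hxpos : 0 < x := by
    by_contra hneg
    nlinarith [sq_nonneg x, sq_nonneg y, mul_nonneg (sq_nonneg y) (neg_nonneg.2 (not_lt.1 hneg))]
  obtain ⟨p, hp⟩ : ∃ p, p = x.num := ⟨_, rfl⟩
  obtain ⟨q, hq⟩ : ∃ q : ℤ, q = x.den := ⟨_, rfl⟩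
  obtain ⟨k, hk⟩ : ∃ k, k = y.num := ⟨_, rfl⟩
  obtain ⟨l, hl⟩ : ∃ l : ℤ, l = y.den := ⟨_, rfl⟩
  have hp0 : 0 < p := hp ▸ Rat.num_pos.2 hxpos
  have hq0 : 0 < q := by rw [hq]; exact_mod_cast x.pos
  have hl0 : 0 < l := by rw [hl]; exact_mod_cast y.pos
  have hpq : IsCoprime p q := by
    rw [hp, hq]; exact Rat.isCoprime_num_den x
  have hkl : IsCoprime k l := by
    rw [hk, hl]; exact Rat.isCoprime_num_den y
  have hx : x = p / q := by rw [hp, hq]; exact_mod_cast (Rat.num_div_den x).symm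
  have hy : y = k / l := by rw [hk, hl]; exact_mod_cast (Rat.num_div_den y).symm
  have hqQ : (q : ℚ) ≠ 0 := by exact_mod_cast hq0.ne'
  have hlQ : (l : ℚ) ≠ 0 := by exact_mod_cast hl0.ne'
  have hint : l ^ 2 * (p ^ 2 - p * q + q ^ 2) = k ^ 2 * (p * q) := by
    rw [hx, hy] at h
    field_simp at h
    have h' : (l : ℚ) ^ 2 * (p ^ 2 - p * q + q ^ 2) = k ^ 2 * (p * q) := by
      linear_combination h
    exact_mod_cast h'
  have hcop : IsCoprime (p * q) (p ^ 2 - p * q + q ^ 2) := by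
    refine IsCoprime.mul_left ?_ ?_
    · have : IsCoprime p (q ^ 2 + p * (p - q)) := by
        rw [IsCoprime.add_mul_left_right_iff]
        exact hpq.pow_right
      convert this using 1; ring
    · have : IsCoprime q (p ^ 2 + q * (q - p)) := by
        rw [IsCoprime.add_mul_left_right_iff]
        exact hpq.symm.pow_right
      convert this using 1; ring
  have hpql : p * q = l ^ 2 := by
    refine Int.dvd_antisymm (by positivity) (by positivity) ?_ ?_
    · exact hcop.dvd_of_dvd_mul_right ⟨k ^ 2, by linear_combination hint⟩
    · have : IsCoprime (l ^ 2) (k ^ 2) := hkl.symm.pow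
      exact this.dvd_of_dvd_mul_left ⟨_, hint.symm⟩
  have hk2 : p ^ 2 - p * q + q ^ 2 = k ^ 2 := by
    refine mul_left_cancel₀ (pow_ne_zero 2 hl0.ne') ?_
    rw [hint, hpql, mul_comm]
  obtain ⟨a, ha⟩ : ∃ a, p = a ^ 2 := by
    obtain ⟨a, ha | ha⟩ := Int.sq_of_isCoprime hpq hpql
    · exact ⟨a, ha⟩
    · nlinarith [sq_nonneg a]
  obtain ⟨b, hb⟩ : ∃ b, q = b ^ 2 := by
    obtain ⟨b, hb | hb⟩ := Int.sq_of_isCoprime hpq.symm ((mul_comm q p).trans hpql)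
    · exact ⟨b, hb⟩
    · nlinarith [sq_nonneg b]
  have hab : IsCoprime a b := by
    rw [ha, hb] at hpq
    exact (IsCoprime.pow_iff two_pos two_pos).1 hpq
  have hab0 : a * b ≠ 0 := by
    refine mul_ne_zero ?_ ?_
    · rintro rfl; simp [ha] at hp0
    · rintro rfl; simp [hb] at hq0
  have heq := sq_eq_sq_of_quartic (c := k) hab hab0 (by rw [← hk2, ha, hb]; ring)
  rw [hx, ha, hb, heq, ← hb, div_self hqQ]

/-- For all rationals `x, y`: if `x² + (1 + y²)x + 1 = 0` then `x = −1` and `y² = 1`;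
and if `x² − (1 + y²)x + 1 = 0` then `x = 1` and `y² = 1`. -/
theorem A4C4_fixed_and_two_cycle_curves (x y : ℚ) :
    (x ^ 2 + (1 + y ^ 2) * x + 1 = 0 → x = -1 ∧ y ^ 2 = 1) ∧
    (x ^ 2 - (1 + y ^ 2) * x + 1 = 0 → x = 1 ∧ y ^ 2 = 1) := by
  refine ⟨fun h => ?_, fun h => ?_⟩
  · have hx : -x = 1 := eq_one_of_sq_sub_eq_zero (y := y) (by linear_combination h)
    obtain rfl : x = -1 := by linarith
    exact ⟨rfl, by linarith⟩
  · obtain rfl := eq_one_of_sq_sub_eq_zero h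
    exact ⟨rfl, by linarith⟩
end

section
/- For all rational numbers a, z, w with a ≠ 1, a ≠ −1, z ≠ w, if a·z² − 1 = (z³ − a·z)·w and a·w² − 1 = (w³ − a·w)·z, then (z, w) = (1, −1) or (z, w) = (−1, 1). That is, for every a ∈ ℚ \ {±1} the map g_a(z) = (a·z² − 1)/(z³ − a·z) has exactly two 2-cycles with ℚ-rational points, namely {0, ∞} and {1, −1}. -/
/-- For all rationals `a, z, w` with `a ≠ ±1` and `z ≠ w`, if
`a z² − 1 = (z³ − a z) w` and `a w² − 1 = (w³ − a w) z`, then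
`(z, w) = (1, −1)` or `(z, w) = (−1, 1)`. -/
theorem A3D2_second_component_two_cycles (a z w : ℚ)
    (ha1 : a ≠ 1) (ha2 : a ≠ -1) (hzw : z ≠ w)
    (h1 : a * z ^ 2 - 1 = (z ^ 3 - a * z) * w)
    (h2 : a * w ^ 2 - 1 = (w ^ 3 - a * w) * z) :
    (z = 1 ∧ w = -1) ∨ (z = -1 ∧ w = 1) := by
  have hfac : (a - z * w) * ((z - w) * (z + w)) = 0 := by linear_combination h1 - h2
  rcases mul_eq_zero.mp hfac with ha | hrest
  · obtain rfl : a = z * w := sub_eq_zero.mp ha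
    have hsq : (z * w) ^ 2 = 1 := by linear_combination h1
    rcases sq_eq_one_iff.mp hsq with h | h
    · exact absurd h ha1
    · exact absurd h ha2
  · have hsum : z + w = 0 := (mul_eq_zero.mp hrest).resolve_left (sub_ne_zero.mpr hzw)
    obtain rfl : w = -z := by linear_combination hsum
    have hprod : (z ^ 2 + 1) * (z ^ 2 - 1) = 0 := by linear_combination h1
    have hsq : z ^ 2 = 1 :=
      sub_eq_zero.mp ((mul_eq_zero.mp hprod).resolve_left (by positivity))
    rcases sq_eq_one_iff.mp hsq with rfl | rfl
    · simp
    · simp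
end

section
/- The only pair of rational numbers (t, l) satisfying l³·(1 − t³) = 1 is (t, l) = (0, 1). (Consequently, for the family f_a(z) = (z³ + a)/(a·z²), no parameter a ∈ ℚ \ {0} simultaneously admits a finite ℚ-rational fixed point and a ℚ-rational preimage of 0.) -/
/-- The only pair of rationals `(t, l)` satisfying `l³·(1 − t³) = 1` is `(0, 1)`. -/
theorem A3C3_fixed_point_and_preimage_curve (t l : ℚ)
    (h : l ^ 3 * (1 - t ^ 3) = 1) :
    t = 0 ∧ l = 1 := by
  have hl : l ≠ 0 := by
    rintro rfl
    norm_num at h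
  have ht : t = 0 := by
    by_contra ht
    refine fermatLastTheoremFor_iff_rat.mp fermatLastTheoremThree 1 (l * t) l
      one_ne_zero (mul_ne_zero hl ht) hl ?_
    linear_combination -h
  refine ⟨ht, ?_⟩
  have hl3 : l ^ 3 = 1 := by simpa [ht] using h
  exact (Odd.strictMono_pow (by decide : Odd 3)).injective (by simpa using hl3)
end

section
/- The only rational solutions (u, v) of the equation v³ = u⁴ + u are (0, 0) and (−1, 0). (Via the substitutions relating it to z³ + z²t⁴ + t³ = 0, this shows that for the family f_a(z) = (z³ + a)/(a·z²) the ℚ-rational preimage of 0, when it exists, has no ℚ-rational preimage of its own.) -/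
/-- If `v³ = u⁴ + u` over `ℚ`, then the numerator and denominator of `u` have cubes summing to
a cube: `v * u.den ^ 2` is an integer whose cube is the product of the coprime integers
`u.num * u.den ^ 2` and `u.num ^ 3 + u.den ^ 3`. -/
theorem exists_num_cube_add_den_cube_eq_cube {u v : ℚ} (h : v ^ 3 = u ^ 4 + u) :
    ∃ b : ℤ, u.num ^ 3 + (u.den : ℤ) ^ 3 = b ^ 3 := by
  have hq : (u.den : ℚ) ≠ 0 := by exact_mod_cast u.den_ne_zero
  have hw : (v * u.den ^ 2) ^ 3 =
      ((u.num * (u.den : ℤ) ^ 2 * (u.num ^ 3 + (u.den : ℤ) ^ 3) : ℤ) : ℚ) := by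
    have hu : u * u.den = u.num := Rat.mul_den_eq_num u
    push_cast
    rw [← hu]
    linear_combination (u.den : ℚ) ^ 6 * h
  obtain ⟨w, hwv⟩ : ∃ w : ℤ, algebraMap ℤ ℚ w = v * u.den ^ 2 :=
    IsIntegrallyClosed.exists_algebraMap_eq_of_isIntegral_pow (n := 3) (by norm_num)
      (hw ▸ isIntegral_algebraMap (R := ℤ) (A := ℚ))
  rw [← hwv, eq_intCast] at hw
  have hprod : u.num * (u.den : ℤ) ^ 2 * (u.num ^ 3 + (u.den : ℤ) ^ 3) = w ^ 3 := by
    exact_mod_cast hw.symm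
  have hcop : IsCoprime u.num (u.den : ℤ) := Rat.isCoprime_num_den u
  have hnum : IsCoprime u.num (u.num ^ 3 + (u.den : ℤ) ^ 3) := by
    rw [pow_succ' u.num 2]
    exact (hcop.pow_right (n := 3)).mul_add_left_right _
  have hden : IsCoprime (u.den : ℤ) (u.num ^ 3 + (u.den : ℤ) ^ 3) := by
    rw [pow_succ' (u.den : ℤ) 2]
    exact (hcop.symm.pow_right (n := 3)).add_mul_left_right _
  exact Int.eq_pow_of_mul_eq_pow_odd_right (hnum.mul_left hden.pow_left) (by decide) hprod

/-- The only rational solutions `(u, v)` of `v³ = u⁴ + u` are `(0, 0)` and `(−1, 0)`. -/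
theorem picard_curve_rational_points (u v : ℚ)
    (h : v ^ 3 = u ^ 4 + u) :
    (u = 0 ∧ v = 0) ∨ (u = -1 ∧ v = 0) := by
  obtain ⟨b, hb⟩ := exists_num_cube_add_den_cube_eq_cube h
  have hu : u = 0 ∨ u = -1 := by
    by_cases hu0 : u = 0
    · exact Or.inl hu0
    have hq : (u.den : ℤ) ≠ 0 := by exact_mod_cast u.den_ne_zero
    have hb0 : b = 0 := by
      by_contra hb0
      exact fermatLastTheoremFor_iff_int.mp fermatLastTheoremThree _ _ b
        (Rat.num_ne_zero.mpr hu0) hq hb0 hb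
    have hneg : u.num = -(u.den : ℤ) := by
      have hodd : Odd 3 := by decide
      rw [← hodd.pow_inj, hodd.neg_pow]
      rw [hb0] at hb
      linarith
    right
    have hnd := Rat.mul_den_eq_num u
    rw [hneg] at hnd
    push_cast at hnd
    have hq' : (u.den : ℚ) ≠ 0 := by exact_mod_cast hq
    exact mul_right_cancel₀ hq' (by linarith)
  rcases hu with rfl | rfl
  · exact Or.inl ⟨rfl, by simpa using h⟩
  · exact Or.inr ⟨rfl, by norm_num at h; exact h⟩
end

section
/- Let a, z ∈ ℚ with a ≠ 1, a ≠ −1 and z³ + a·z ≠ 0, and set w = (a·z² + 1)/(z³ + a·z). If w³ + a·w ≠ 0 and (a·w² + 1)/(w³ + a·w) = 1, then w = 1. In other words, for f_a(z) = (a·z² + 1)/(z³ + a·z) and any a ∈ ℚ \ {±1}, every ℚ-rational second preimage of the fixed point 1 is already a first preimage: f_a²(z) = 1 implies f_a(z) = 1. -/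
/-- A factorization of `5 * Y ^ 4` into two factors whose sum is positive and coprime to `Y`
splits into a fourth power and five times a fourth power. -/
theorem exists_fourth_powers_of_mul_eq_five_mul_pow {P Q Y : ℤ} (hS : 0 < P + Q) (hY : Y ≠ 0)
    (hc : IsCoprime Y (P + Q)) (h : P * Q = 5 * Y ^ 4) :
    ∃ A B : ℤ, IsCoprime A B ∧ (A * B) ^ 2 = Y ^ 2 ∧ P + Q = A ^ 4 + 5 * B ^ 4 := by
  have hY4 : 0 < Y ^ 4 := by positivity
  have hP : 0 < P := by
    by_contra! hP
    nlinarith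
  have hQ : 0 < Q := by
    by_contra! hQ
    nlinarith
  have hPQ : IsCoprime P Q := by
    refine isCoprime_of_prime_dvd (by omega) fun p hp hpP hpQ => ?_
    have hpY : ¬ p ∣ Y := fun hpY => hp.not_isUnit (hc.isUnit_of_dvd' hpY (dvd_add hpP hpQ))
    have h2 : p ^ 2 ∣ 5 * Y ^ 4 := by
      rw [← h, sq]
      exact mul_dvd_mul hpP hpQ
    have hco : IsCoprime (p ^ 2) (Y ^ 4) := ((Prime.coprime_iff_not_dvd hp).2 hpY).pow
    have h5 : p ^ 2 ∣ 5 := hco.dvd_of_dvd_mul_right h2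
    have hle := Int.le_of_dvd (by norm_num) h5
    have h1 : p ≤ 2 := by nlinarith
    have h3 : -2 ≤ p := by nlinarith
    interval_cases p <;> revert h5 <;> first | decide | exact fun _ => by simp_all
  clear hS hc
  wlog h5 : (5 : ℤ) ∣ Q generalizing P Q
  · have hp5 : Prime (5 : ℤ) := by norm_num
    have hdvd : (5 : ℤ) ∣ P := (hp5.dvd_or_dvd ⟨_, h⟩).resolve_right h5
    rw [add_comm]
    exact this (by rw [mul_comm, h]) hQ hP hPQ.symm hdvd
  obtain ⟨R, rfl⟩ := h5
  have hR : 0 < R := by omega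
  have hPR : IsCoprime P R := hPQ.of_mul_right_right
  have hmul : P * R = Y ^ 4 := by linarith
  have key : ∀ {U V : ℤ}, 0 < U → IsCoprime U V → U * V = Y ^ 4 → ∃ A : ℤ, U = A ^ 4 := by
    intro U V hU hUV hm
    obtain ⟨A, hA⟩ := exists_associated_pow_of_mul_eq_pow' hUV hm
    rcases Int.associated_iff.1 hA with hA | hA
    · exact ⟨A, hA.symm⟩
    · nlinarith [sq_nonneg (A ^ 2)]
  obtain ⟨A, rfl⟩ := key hP hPR hmul
  obtain ⟨B, rfl⟩ := key hR hPR.symm (by rw [mul_comm, hmul])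
  refine ⟨A, B, ?_, ?_, rfl⟩
  · exact (IsCoprime.pow_iff (by norm_num) (by norm_num)).1 hPR
  · have : ((A * B) ^ 2) ^ 2 = (Y ^ 2) ^ 2 := by linear_combination hmul
    exact (sq_eq_sq₀ (sq_nonneg _) (sq_nonneg _)).1 this

/-- Parametrization of a primitive Pythagorean triple with odd first leg. -/
theorem pythagorean_parametrization_of_odd {x y z : ℤ} (h : x ^ 2 + y ^ 2 = z ^ 2)
    (hc : IsCoprime x y) (hx : Odd x) :
    ∃ m n : ℤ, x = m ^ 2 - n ^ 2 ∧ y = 2 * m * n ∧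
      (z = m ^ 2 + n ^ 2 ∨ z = -(m ^ 2 + n ^ 2)) ∧ IsCoprime m n := by
  have hp : PythagoreanTriple x y z := by
    unfold PythagoreanTriple
    linarith
  obtain ⟨m, n, hxy, hz, hmn, -⟩ :=
    PythagoreanTriple.coprime_classification.1 ⟨hp, Int.isCoprime_iff_gcd_eq_one.1 hc⟩
  refine ⟨m, n, ?_⟩
  rcases hxy with ⟨h1, h2⟩ | ⟨h1, -⟩
  · exact ⟨h1, h2, hz.imp id (by intro h; linarith), Int.isCoprime_iff_gcd_eq_one.2 hmn⟩
  · exact absurd hx (Int.not_odd_iff_even.2 ⟨m * n, by rw [h1]; ring⟩)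

/-- The only coprime odd solutions of `4x² = A⁴ - 2A²B² + 5B⁴` have `A, B = ±1`. -/
theorem sq_eq_one_of_four_mul_sq_eq {A B x : ℤ} (hA : Odd A) (hB : Odd B) (hAB : IsCoprime A B)
    (h : 4 * x ^ 2 = A ^ 4 - 2 * A ^ 2 * B ^ 2 + 5 * B ^ 4) : A ^ 2 = 1 ∧ B ^ 2 = 1 := by
  induction hk : B.natAbs using Nat.strong_induction_on generalizing A B x with
  | _ k ih =>
  obtain ⟨k, hk4⟩ : (4 : ℤ) ∣ A ^ 2 - B ^ 2 := by
    obtain ⟨i, rfl⟩ := hA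
    obtain ⟨j, rfl⟩ := hB
    exact ⟨i ^ 2 + i - j ^ 2 - j, by ring⟩
  have hcop : IsCoprime (B ^ 2) (2 * k) := by
    have h1 : IsCoprime (B ^ 2) (A ^ 2 + B ^ 2 * (-1)) :=
      (hAB.symm.pow (m := 2) (n := 2)).add_mul_left_right (-1)
    rw [show A ^ 2 + B ^ 2 * (-1) = 2 * (2 * k) by linear_combination hk4] at h1
    exact h1.of_mul_right_right
  have hx : (B ^ 2) ^ 2 + (2 * k) ^ 2 = x ^ 2 := by
    have h1 : 4 * x ^ 2 = (A ^ 2 - B ^ 2) ^ 2 + 4 * B ^ 4 := by linear_combination h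
    rw [hk4] at h1
    linarith
  obtain ⟨c, d, hBc, hkd, -, hcd⟩ := pythagorean_parametrization_of_odd hx hcop hB.pow
  have hBd : IsCoprime B d := by
    have h1 : IsCoprime (c ^ 2 + d * (-d)) d := (hcd.pow_left (m := 2)).add_mul_left_left (-d)
    rw [show c ^ 2 + d * (-d) = B ^ 2 by linear_combination -hBc] at h1
    exact (IsCoprime.pow_left_iff (by norm_num)).1 h1
  obtain ⟨u, v, hBuv, hduv, hcuv, huv⟩ :=
    pythagorean_parametrization_of_odd (z := c) (by linear_combination hBc) hBd hB
  obtain ⟨X, Y, hXY, hBXY, hAXY⟩ : ∃ X Y : ℤ, IsCoprime X Y ∧ B = X * Y ∧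
      A ^ 2 = X ^ 4 + X ^ 2 * Y ^ 2 - Y ^ 4 := by
    have hB' : B = (u + v) * (u - v) := by linear_combination hBuv
    have hco : IsCoprime (u + v) (u - v) := by
      have hodd : Odd (u + v) := (Int.odd_mul.1 (hB' ▸ hB)).1
      have h1 : IsCoprime (u + v) u := by
        simpa [add_comm] using (huv.symm.add_mul_left_left 1)
      have h2 : IsCoprime (u + v) 2 := Int.isCoprime_two_right.2 hodd
      have h3 := (h2.mul_right h1).add_mul_left_right (-1)
      rwa [show 2 * u + (u + v) * (-1) = u - v by ring] at h3
    have hA2 : A ^ 2 = B ^ 2 + 4 * c * d := by linear_combination hk4 + 2 * hkd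
    rcases hcuv with rfl | rfl
    · exact ⟨u + v, u - v, hco, hB', by rw [hA2, hBuv, hduv]; ring⟩
    · exact ⟨u - v, u + v, hco.symm, by rw [hB']; ring, by rw [hA2, hBuv, hduv]; ring⟩
  obtain ⟨hXodd, hYodd⟩ := Int.odd_mul.1 (hBXY ▸ hB)
  have hX0 : X ≠ 0 := by rintro rfl; simp at hXodd
  have hY0 : Y ≠ 0 := by rintro rfl; simp at hYodd
  have hcY : IsCoprime Y (4 * X ^ 2 + Y * (2 * Y)) := by
    refine IsCoprime.add_mul_left_right ?_ _
    refine IsCoprime.mul_right ?_ hXY.symm.pow_right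
    exact (Int.isCoprime_two_right.2 hYodd).pow_right (n := 2)
  obtain ⟨A', B', hAB', hY', hS⟩ :=
    exists_fourth_powers_of_mul_eq_five_mul_pow (P := 2 * X ^ 2 + Y ^ 2 - 2 * A)
      (Q := 2 * X ^ 2 + Y ^ 2 + 2 * A) (by ring_nf; positivity) hY0
      (by convert hcY using 1; ring) (by linear_combination -4 * hAXY)
  have hodd : Odd ((A' * B') ^ 2) := hY' ▸ hYodd.pow
  obtain ⟨hAodd', hBodd'⟩ := Int.odd_mul.1 ((Int.odd_pow' (by norm_num)).1 hodd)
  have hX4 : 4 * X ^ 2 = A' ^ 4 - 2 * A' ^ 2 * B' ^ 2 + 5 * B' ^ 4 := by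
    linear_combination hS + 2 * hY'
  have hB2 : B ^ 2 = (X * A') ^ 2 * B' ^ 2 := by rw [hBXY]; linear_combination -X ^ 2 * hY'
  have hone : A' ^ 2 = 1 ∧ B' ^ 2 = 1 := by
    rcases lt_or_ge B'.natAbs B.natAbs with hlt | hge
    · exact ih _ (hk ▸ hlt) hAodd' hBodd' hAB' hX4 rfl
    · have hB0' : B' ≠ 0 := by rintro rfl; simp at hBodd'
      have hA0' : A' ≠ 0 := by rintro rfl; simp at hAodd'
      have hle : B ^ 2 ≤ B' ^ 2 := Int.natAbs_le_iff_sq_le.1 hge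
      have hBpos : 0 < B' ^ 2 := by positivity
      have hApos : 0 < A' ^ 2 := by positivity
      have hXpos : 0 < X ^ 2 := by positivity
      have hXA : X ^ 2 * A' ^ 2 ≤ 1 := by nlinarith
      have hA1 : A' ^ 2 = 1 := by nlinarith
      have hX1 : X ^ 2 = 1 := by nlinarith
      refine ⟨hA1, ?_⟩
      have hprod : (B' ^ 2 - 1) * (5 * B' ^ 2 + 3) = 0 := by
        linear_combination 4 * hX1 - hX4 - (A' ^ 2 + 1 - 2 * B' ^ 2) * hA1
      rcases mul_eq_zero.1 hprod with h0 | h0 <;> linarith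
  obtain ⟨hA1, hB1⟩ := hone
  have hY1 : Y ^ 2 = 1 := by rw [← hY', mul_pow, hA1, hB1, one_mul]
  have hX1 : X ^ 2 = 1 := by
    rw [show A' ^ 4 = (A' ^ 2) ^ 2 by ring, show B' ^ 4 = (B' ^ 2) ^ 2 by ring, hA1, hB1] at hX4
    linarith
  constructor
  · rw [hAXY, show X ^ 4 = (X ^ 2) ^ 2 by ring, show Y ^ 4 = (Y ^ 2) ^ 2 by ring, hX1, hY1]
    norm_num
  · rw [hBXY, mul_pow, hX1, hY1, one_mul]

/-- Coprime solutions of `x² = A⁴ - 2A²B² + 5B⁴` of opposite parity have `B = 0`. -/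
theorem eq_zero_of_sq_eq_of_odd_add {A B x : ℤ} (hodd : Odd (A + B)) (hAB : IsCoprime A B)
    (h : x ^ 2 = A ^ 4 - 2 * A ^ 2 * B ^ 2 + 5 * B ^ 4) : B = 0 := by
  induction hk : B.natAbs using Nat.strong_induction_on generalizing A B x with
  | _ k ih =>
  by_contra hB0
  have hBeven : Even B := by
    by_contra hB
    rw [Int.not_even_iff_odd] at hB
    obtain ⟨j, rfl⟩ := hB
    obtain ⟨i, rfl⟩ : Even A := by
      by_contra hA
      rw [Int.not_even_iff_odd] at hA
      exact Int.not_even_iff_odd.2 hodd (hA.add_odd ⟨j, rfl⟩)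
    have hx8 : x ^ 2 % 8 = 5 := by
      have : x ^ 2 = 8 * (2 * i ^ 4 - i ^ 2 * (2 * j + 1) ^ 2
        + 5 * (2 * j ^ 4 + 4 * j ^ 3 + 3 * j ^ 2 + j)) + 5 := by
        rw [h]; ring
      omega
    have : x % 8 = 0 ∨ x % 8 = 1 ∨ x % 8 = 2 ∨ x % 8 = 3 ∨ x % 8 = 4 ∨ x % 8 = 5 ∨ x % 8 = 6 ∨
      x % 8 = 7 := by omega
    rcases this with h | h | h | h | h | h | h | h <;> simp [sq, Int.mul_emod, h] at hx8
  have hAodd : Odd A := by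
    by_contra hA
    exact Int.not_even_iff_odd.2 hodd ((Int.not_odd_iff_even.1 hA).add hBeven)
  have hcop : IsCoprime (A ^ 2 - B ^ 2) (2 * B ^ 2) := by
    have hO : Odd (A ^ 2 - B ^ 2) :=
      hAodd.pow.sub_even ((Int.even_pow' (by norm_num)).2 hBeven)
    refine (Int.isCoprime_two_right.2 hO).mul_right ?_
    have h1 := (hAB.pow (m := 2) (n := 2)).add_mul_left_left (-1)
    rwa [show A ^ 2 + B ^ 2 * (-1) = A ^ 2 - B ^ 2 by ring] at h1
  obtain ⟨c, d, hABc, hBcd, -, hcd⟩ := pythagorean_parametrization_of_odd (z := x)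
    (by linear_combination -h) hcop
    (hAodd.pow.sub_even ((Int.even_pow' (by norm_num)).2 hBeven))
  have hBcd : c * d = B ^ 2 := by linarith
  obtain ⟨γ, δ, hγδ, hB2, hA2⟩ : ∃ γ δ : ℤ, IsCoprime γ δ ∧ B ^ 2 = γ ^ 2 * δ ^ 2 ∧
      A ^ 2 = γ ^ 4 + γ ^ 2 * δ ^ 2 - δ ^ 4 := by
    obtain ⟨γ, hγ⟩ := Int.sq_of_isCoprime hcd hBcd
    obtain ⟨δ, hδ⟩ := Int.sq_of_isCoprime hcd.symm (by rw [mul_comm, hBcd])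
    have hBpos : 0 < B ^ 2 := by positivity
    have hcd' : c ^ 2 = γ ^ 4 ∧ d ^ 2 = δ ^ 4 ∧ c * d = γ ^ 2 * δ ^ 2 := by
      have hnn : 0 ≤ γ ^ 2 * δ ^ 2 := by positivity
      rcases hγ with rfl | rfl <;> rcases hδ with rfl | rfl
      · exact ⟨by ring, by ring, by ring⟩
      · nlinarith
      · nlinarith
      · exact ⟨by ring, by ring, by ring⟩
    obtain ⟨h1, h2, h3⟩ := hcd'
    refine ⟨γ, δ, ?_, by rw [← hBcd, h3], ?_⟩
    · have : IsCoprime (c ^ 2) (d ^ 2) := hcd.pow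
      rw [h1, h2] at this
      exact (IsCoprime.pow_iff (by norm_num) (by norm_num)).1 this
    · linear_combination hABc - hBcd + h1 - h2 + h3
  have hδ : Even δ := by
    by_contra hδ
    obtain ⟨j, rfl⟩ := Int.not_even_iff_odd.1 hδ
    have hev : Even (γ ^ 2 * (2 * j + 1) ^ 2) := hB2 ▸ (Int.even_pow' (by norm_num)).2 hBeven
    obtain ⟨i, rfl⟩ : Even γ := by
      rcases Int.even_mul.1 hev with h1 | h1
      · exact (Int.even_pow' (by norm_num)).1 h1
      · exact absurd ((Int.even_pow' (by norm_num)).1 h1) hδ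
    obtain ⟨l, rfl⟩ := hAodd
    ring_nf at hA2
    omega
  obtain ⟨Y, hY⟩ := even_iff_two_dvd.1 hδ
  subst hY
  have hγodd : Odd γ := Int.isCoprime_two_right.1 hγδ.of_mul_right_left
  have hγY : IsCoprime γ Y := hγδ.of_mul_right_right
  obtain ⟨l, hl⟩ := hAodd
  obtain ⟨i, hi⟩ := hγodd
  have hγ0 : γ ≠ 0 := by omega
  have hY0 : Y ≠ 0 := by
    rintro rfl
    simp at hB2
    exact hB0 hB2
  obtain ⟨P, hP⟩ : ∃ P, 2 * P = γ ^ 2 + 2 * Y ^ 2 - A :=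
    ⟨2 * i ^ 2 + 2 * i + Y ^ 2 - l, by rw [hl, hi]; ring⟩
  obtain ⟨A', B', hAB', hY', hS⟩ :=
    exists_fourth_powers_of_mul_eq_five_mul_pow (P := P) (Q := P + A) (Y := Y)
      (by have : P + (P + A) = γ ^ 2 + 2 * Y ^ 2 := by linarith
          rw [this]; positivity) hY0
      (by have h1 := (hγY.symm.pow_right (n := 2)).add_mul_left_right (2 * Y)
          rwa [show γ ^ 2 + Y * (2 * Y) = P + (P + A) by linear_combination -hP] at h1)
      (by have : (2 * P) * (2 * P + 2 * A) = 20 * Y ^ 4 := by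
            rw [hP]; linear_combination -hA2
          linarith)
  have hγ' : γ ^ 2 = A' ^ 4 - 2 * A' ^ 2 * B' ^ 2 + 5 * B' ^ 4 := by
    linear_combination hS - hP + 2 * hY'
  have hodd' : Odd (A' + B') := by
    have h1 : Odd (γ ^ 2) := (hi ▸ ⟨i, rfl⟩ : Odd γ).pow
    rw [hγ'] at h1
    have h5 : ¬ Even (5 : ℤ) := by decide
    simpa [parity_simps, h5] using h1
  have hA0' : A' ≠ 0 := by
    rintro rfl
    simp at hY'
    exact hY0 (pow_eq_zero_iff two_ne_zero |>.1 hY'.symm)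
  have hB0' : B' ≠ 0 := by
    rintro rfl
    simp at hY'
    exact hY0 (pow_eq_zero_iff two_ne_zero |>.1 hY'.symm)
  refine hB0' (ih _ ?_ hodd' hAB' hγ' rfl)
  rw [← hk, Int.natAbs_lt_iff_sq_lt]
  have h1 : B ^ 2 = 4 * (γ ^ 2 * A' ^ 2) * B' ^ 2 := by
    linear_combination hB2 - 4 * γ ^ 2 * hY'
  have h2 : 0 < γ ^ 2 * A' ^ 2 := by positivity
  have h3 : 0 < B' ^ 2 := by positivity
  nlinarith

/-- The affine rational points of `y² = s⁴ - 4s³ + 10s² - 4s + 1` lie over `s = 0` and `s = 1`. -/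
theorem eq_zero_or_one_of_sq_eq_quartic {s y : ℚ}
    (h : y ^ 2 = s ^ 4 - 4 * s ^ 3 + 10 * s ^ 2 - 4 * s + 1) : s = 0 ∨ s = 1 := by
  obtain ⟨m, n, hn0, hmn, hs⟩ : ∃ m n : ℤ, n ≠ 0 ∧ IsCoprime m n ∧ s * n = m :=
    ⟨s.num, s.den, by exact_mod_cast s.den_ne_zero,
      Int.isCoprime_iff_gcd_eq_one.2 (by simpa [Int.gcd] using s.reduced),
      by exact_mod_cast Rat.mul_den_eq_num s⟩
  have hnQ : (n : ℚ) ≠ 0 := by exact_mod_cast hn0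
  obtain ⟨r, hr⟩ : ∃ r : ℤ, r ^ 2 = (m - n) ^ 4 + 4 * m ^ 2 * n ^ 2 := by
    have hsq : IsSquare (((m - n) ^ 4 + 4 * m ^ 2 * n ^ 2 : ℤ) : ℚ) := by
      refine ⟨y * n ^ 2, ?_⟩
      push_cast
      rw [← hs]
      linear_combination -(n : ℚ) ^ 4 * h
    obtain ⟨r, hr⟩ := Rat.isSquare_intCast_iff.1 hsq
    exact ⟨r, by rw [hr, sq]⟩
  rcases Int.even_or_odd (m - n) with ⟨b, hb⟩ | hmodd
  · have hm : m = n + 2 * b := by linarith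
    have hnb : IsCoprime (n + b) b := by
      have h1 : IsCoprime (n + 2 * b) n := hm ▸ hmn
      obtain ⟨i, j, hij⟩ := h1
      exact ⟨i + j, i - j, by linear_combination hij⟩
    obtain ⟨q, rfl⟩ : (2 : ℤ) ∣ r := by
      refine Int.prime_two.dvd_of_dvd_pow (n := 2) ?_
      rw [hr, hm]
      exact ⟨8 * b ^ 4 + 2 * (n + 2 * b) ^ 2 * n ^ 2, by ring⟩
    have hnodd : Odd n := by
      by_contra hne
      obtain ⟨i, hi⟩ := Int.not_odd_iff_even.1 hne
      have := hmn.isUnit_of_dvd' (x := 2) ⟨i + b, by omega⟩ ⟨i, by omega⟩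
      exact absurd this (by decide)
    have hodd : Odd ((n + b) + b) := by
      have : n + b + b = n + (b + b) := by ring
      rw [this]
      exact hnodd.add_even ⟨b, rfl⟩
    have hb0 : b = 0 := eq_zero_of_sq_eq_of_odd_add (x := q) hodd hnb (by
      have : 4 * q ^ 2 = (2 * b) ^ 4 + 4 * (n + 2 * b) ^ 2 * n ^ 2 := by
        rw [hm] at hr
        linear_combination hr
      linarith)
    right
    have : (m : ℚ) = n := by rw [hm, hb0]; simp
    rw [this] at hs
    exact mul_right_cancel₀ hnQ (by rw [hs, one_mul])
  · have hodd : Odd (m + n) := by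
      have : m + n = (m - n) + 2 * n := by ring
      rw [this]
      exact hmodd.add_even (even_two_mul n)
    have hco : IsCoprime (m + n) (m - n) := by
      have h1 : IsCoprime (m + n) m := by
        simpa [add_comm] using (hmn.symm.add_mul_left_left 1)
      have h3 := ((Int.isCoprime_two_right.2 hodd).mul_right h1).add_mul_left_right (-1)
      rwa [show 2 * m + (m + n) * (-1) = m - n by ring] at h3
    obtain ⟨h1, h2⟩ := sq_eq_one_of_four_mul_sq_eq (x := r) hodd hmodd hco (by
      linear_combination 4 * hr)
    have hmn0 : m * n = 0 := by linarith
    left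
    have hm0 : m = 0 := (mul_eq_zero.1 hmn0).resolve_right hn0
    rw [hm0] at hs
    simpa [hnQ] using hs

/-- For `f_a(z) = (a z² + 1)/(z³ + a z)` with `a ≠ ±1`: every ℚ-rational second
preimage of the fixed point `1` is already a first preimage; that is, if
`w = f_a(z)` satisfies `f_a(w) = 1` (with nonvanishing denominators), then `w = 1`. -/
theorem A3D2_first_component_second_preimages_of_one (a z : ℚ)
    (ha1 : a ≠ 1) (ha2 : a ≠ -1) (hden : z ^ 3 + a * z ≠ 0)
    (hwden : ((a * z ^ 2 + 1) / (z ^ 3 + a * z)) ^ 3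
        + a * ((a * z ^ 2 + 1) / (z ^ 3 + a * z)) ≠ 0)
    (h : (a * ((a * z ^ 2 + 1) / (z ^ 3 + a * z)) ^ 2 + 1) /
          (((a * z ^ 2 + 1) / (z ^ 3 + a * z)) ^ 3
            + a * ((a * z ^ 2 + 1) / (z ^ 3 + a * z))) = 1) :
    (a * z ^ 2 + 1) / (z ^ 3 + a * z) = 1 := by
  have ha : a - 1 ≠ 0 := sub_ne_zero.2 ha1
  have hz : z ≠ 0 := by
    rintro rfl
    simp at hden
  have hz1 : z ^ 2 + 1 ≠ 0 := by positivity
  rw [div_eq_one_iff_eq hwden] at h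
  set w := (a * z ^ 2 + 1) / (z ^ 3 + a * z) with hw
  by_contra hw1
  have hquad : w ^ 2 + (1 - a) * w + 1 = 0 := by
    refine (mul_eq_zero.1 (?_ : (w - 1) * _ = 0)).resolve_left (sub_ne_zero.2 hw1)
    linear_combination -h
  have hwz : w * (z ^ 3 + a * z) = a * z ^ 2 + 1 := by
    rw [hw, div_mul_cancel₀ _ hden]
  have hcurve : (a * z ^ 2 + 1) ^ 2 + (1 - a) * (a * z ^ 2 + 1) * (z ^ 3 + a * z)
      + (z ^ 3 + a * z) ^ 2 = 0 := by
    rw [← hwz]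
    linear_combination (z ^ 3 + a * z) ^ 2 * hquad
  obtain ⟨s, hs⟩ : ∃ s : ℚ, s * (z ^ 2 + 1) = (a - 1) * z :=
    ⟨(a - 1) * z / (z ^ 2 + 1), div_mul_cancel₀ _ hz1⟩
  have hs0 : s ≠ 0 := by
    rintro rfl
    exact mul_ne_zero ha hz (by rw [← hs, zero_mul])
  have hsb : s * (a - 1) ^ 2 + (s - 1) * (s ^ 2 + 1) * (a - 1) - 4 * s ^ 2 = 0 := by
    refine (mul_eq_zero.1 (?_ : (z ^ 2 + 1) ^ 3 * _ = 0)).resolve_left (pow_ne_zero 3 hz1)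
    obtain rfl : s = (a - 1) * z / (z ^ 2 + 1) := (eq_div_iff hz1).2 hs
    field_simp
    linear_combination -(a - 1) * hcurve
  have hsq : (2 * s * (a - 1) + (s - 1) * (s ^ 2 + 1)) ^ 2
      = (s + 1) ^ 2 * (s ^ 4 - 4 * s ^ 3 + 10 * s ^ 2 - 4 * s + 1) := by
    linear_combination 4 * s * hsb
  have hs1 : s + 1 ≠ 0 := by
    intro h0
    obtain rfl : s = -1 := by linarith
    have h1 : 2 * -1 * (a - 1) + (-1 - 1) * ((-1) ^ 2 + 1) = 0 := by
      refine pow_eq_zero_iff (two_ne_zero) |>.1 (hsq.trans (by norm_num))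
    exact ha2 (by linarith)
  rcases eq_zero_or_one_of_sq_eq_quartic (s := s)
    (y := (2 * s * (a - 1) + (s - 1) * (s ^ 2 + 1)) / (s + 1))
    (by rw [div_pow, hsq, mul_div_cancel_left₀ _ (pow_ne_zero 2 hs1)]) with h0 | rfl
  · exact hs0 h0
  have h4 : (a - 3) * (a + 1) = 0 := by linear_combination hsb
  obtain rfl : a = 3 := by
    rcases mul_eq_zero.1 h4 with h0 | h0
    · linarith
    · exact absurd (by linarith) ha2
  have hz' : z = 1 := by
    have : (z - 1) ^ 2 = 0 := by linear_combination hs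
    exact sub_eq_zero.1 (pow_eq_zero_iff two_ne_zero |>.1 this)
  exact hw1 (by rw [hw, hz']; norm_num)
end

section
/- There are no rational numbers t and l with t² − t·l³ + 1 = 0. (Consequently, for the family f_k(z) = (z⁴ + k·z)/(k·z³ + 1), no parameter k ∈ ℚ \ {±1} simultaneously admits extra non-periodic ℚ-rational preimages of the fixed point 1, which require k = t + 1/t, and non-periodic ℚ-rational preimages of the fixed points 0 and ∞, which require k = l³.) -/
/-- If `(a² + b²) d³ = a b c³` with `a, b` coprime and `c, d` coprime, then `a b` is a cube. -/
theorem exists_mul_eq_cube_of_sq_add_sq_mul_cube_eq {a b c d : ℤ} (hab : IsCoprime a b)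
    (hcd : IsCoprime c d) (h : (a ^ 2 + b ^ 2) * d ^ 3 = a * b * c ^ 3) :
    ∃ e : ℤ, a * b = e ^ 3 := by
  have ha : IsCoprime a (a ^ 2 + b ^ 2) := by
    simpa [sq, add_comm] using (hab.pow_right (n := 2)).add_mul_left_right a
  have hb : IsCoprime b (a ^ 2 + b ^ 2) := by
    simpa [sq] using (hab.symm.pow_right (n := 2)).add_mul_left_right b
  have h₁ : a * b ∣ d ^ 3 := (ha.mul_left hb).dvd_of_dvd_mul_left ⟨c ^ 3, h⟩
  have h₂ : d ^ 3 ∣ a * b :=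
    (hcd.pow (m := 3) (n := 3)).symm.dvd_of_dvd_mul_right ⟨a ^ 2 + b ^ 2, by linarith⟩
  rcases Int.associated_iff.mp (associated_of_dvd_dvd h₁ h₂) with h | h
  · exact ⟨d, h⟩
  · exact ⟨-d, by rw [h]; ring⟩

/-- There are no rationals `t, l` with `t² − t·l³ + 1 = 0`. -/
theorem A4D3_no_simultaneous_preimages :
    ¬ ∃ t l : ℚ, t ^ 2 - t * l ^ 3 + 1 = 0 := by
  rintro ⟨t, l, h⟩
  have ht : t ≠ 0 := by rintro rfl; norm_num at h
  have ha : t.num ≠ 0 := Rat.num_ne_zero.mpr ht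
  have hb : (t.den : ℤ) ≠ 0 := by exact_mod_cast t.den_ne_zero
  have hd : (l.den : ℤ) ≠ 0 := by exact_mod_cast l.den_ne_zero
  have hab : IsCoprime t.num (t.den : ℤ) := t.isCoprime_num_den
  have hcd : IsCoprime l.num (l.den : ℤ) := l.isCoprime_num_den
  have key : (t.num ^ 2 + (t.den : ℤ) ^ 2) * (l.den : ℤ) ^ 3 =
      t.num * t.den * l.num ^ 3 := by
    have hb' : (t.den : ℚ) ≠ 0 := by exact_mod_cast hb
    have hd' : (l.den : ℚ) ≠ 0 := by exact_mod_cast hd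
    rw [← Rat.num_div_den t, ← Rat.num_div_den l] at h
    field_simp at h
    have : ((t.num : ℚ) ^ 2 + (t.den : ℚ) ^ 2) * (l.den : ℚ) ^ 3 =
      t.num * t.den * l.num ^ 3 := by linear_combination h
    exact_mod_cast this
  generalize t.num = a at *
  generalize (t.den : ℤ) = b at *
  generalize l.num = c at *
  generalize (l.den : ℤ) = d at *
  obtain ⟨e, he⟩ := exists_mul_eq_cube_of_sq_add_sq_mul_cube_eq hab hcd key
  obtain ⟨u, rfl⟩ := Int.eq_pow_of_mul_eq_pow_odd_left hab (by decide) he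
  obtain ⟨v, rfl⟩ := Int.eq_pow_of_mul_eq_pow_odd_right hab (by decide) he
  have hu : u ≠ 0 := by rintro rfl; simp at ha
  have hv : v ≠ 0 := by rintro rfl; simp at hb
  have hdvd : d ^ 3 ∣ (u * v * c) ^ 3 :=
    ⟨(u ^ 3) ^ 2 + (v ^ 3) ^ 2, by linear_combination -key⟩
  obtain ⟨w, hw⟩ := (Int.pow_dvd_pow_iff three_ne_zero).mp hdvd
  have hflt : (u ^ 2) ^ 3 + (v ^ 2) ^ 3 = w ^ 3 := by
    refine mul_right_cancel₀ (pow_ne_zero 3 hd) ?_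
    calc ((u ^ 2) ^ 3 + (v ^ 2) ^ 3) * d ^ 3 = (u * v * c) ^ 3 := by linear_combination key
      _ = w ^ 3 * d ^ 3 := by rw [hw]; ring
  have hw0 : w ≠ 0 := by
    rintro rfl
    have : 0 < (u ^ 2) ^ 3 + (v ^ 2) ^ 3 := by positivity
    simp [hflt] at this
  exact fermatLastTheoremFor_iff_int.mp fermatLastTheoremThree _ _ _
    (pow_ne_zero 2 hu) (pow_ne_zero 2 hv) hw0 hflt
end

section
/- For all rational numbers t and l, if l² = t⁴ + 2t³ − t² + 2t + 1 then t = 0 and l = 1 or l = −1. (This shows that for the family f_k(z) = (z⁴ + k·z)/(k·z³ + 1) with k = t² + t + 1 + t⁻¹ + t⁻², the quadratic factor z²t + z(t² + t + 1) + t of the second dynatomic polynomial never contributes ℚ-rational points of period 2.) -/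
/-- An odd integer has square congruent to `1` modulo `8`. -/
lemma exists_sq_eq_eight_mul_add_one {a : ℤ} (ha : a % 2 = 1) : ∃ q, a ^ 2 = 8 * q + 1 := by
  obtain ⟨q, hq⟩ := Int.eight_dvd_sq_sub_one_of_odd (Int.odd_iff.mpr ha)
  exact ⟨q, by linarith⟩

/-- If a product of coprime nonnegative integers is a square, both factors are squares. -/
lemma exists_sq_and_sq_of_mul_eq_sq {a b c : ℤ} (hab : IsCoprime a b) (ha : 0 ≤ a) (hb : 0 ≤ b)
    (h : a * b = c ^ 2) : (∃ x, a = x ^ 2) ∧ ∃ y, b = y ^ 2 := by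
  constructor
  · obtain ⟨x, hx | hx⟩ := Int.sq_of_isCoprime hab h
    · exact ⟨x, hx⟩
    · exact ⟨0, by nlinarith [sq_nonneg x]⟩
  · obtain ⟨x, hx | hx⟩ := Int.sq_of_isCoprime hab.symm (by rw [mul_comm]; exact h)
    · exact ⟨x, hx⟩
    · exact ⟨0, by nlinarith [sq_nonneg x]⟩

/-- The descent step: the common difference of two parametrized Pythagorean triples yields a
smaller solution of the concordant equations. -/
lemma exists_concordant_of_sq_sub_sq_eq {m n u v : ℤ} (hmn : IsCoprime m n)
    (huv : IsCoprime u (4 * v)) (hu : u % 2 = 1) (hm0 : m ≠ 0) (hn0 : n ≠ 0)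
    (hprod : u * v = m * n) (hsq : m ^ 2 - n ^ 2 = u ^ 2 - (4 * v) ^ 2) :
    ∃ i j k l : ℤ, l ∣ n ∧ l ≠ 0 ∧ IsCoprime i l ∧ i % 2 = 1 ∧ i ^ 2 + l ^ 2 = j ^ 2 ∧
      i ^ 2 + 16 * l ^ 2 = k ^ 2 := by
  obtain ⟨i, k, ⟨j, rfl⟩, ⟨l, rfl⟩, rfl⟩ :=
    exists_dvd_and_dvd_of_dvd_mul (Dvd.intro _ hprod : u ∣ m * n)
  have hi0 : i ≠ 0 := left_ne_zero_of_mul hm0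
  have hj0 : j ≠ 0 := right_ne_zero_of_mul hm0
  have hk0 : k ≠ 0 := left_ne_zero_of_mul hn0
  have hl0 : l ≠ 0 := right_ne_zero_of_mul hn0
  obtain rfl : v = j * l := by
    apply mul_left_cancel₀ (mul_ne_zero hi0 hk0)
    linarith
  have hil : IsCoprime i l := hmn.of_mul_left_left.of_mul_right_right
  have hjk : IsCoprime j k := hmn.of_mul_left_right.of_mul_right_left
  have hi : i % 2 = 1 := by
    rcases Int.emod_two_eq i with h | h
    · simp [Int.mul_emod, h] at hu
    · exact h
  have hk : k % 2 = 1 := by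
    rcases Int.emod_two_eq k with h | h
    · simp [Int.mul_emod, h] at hu
    · exact h
  have key : i ^ 2 * (j ^ 2 - k ^ 2) = l ^ 2 * (k ^ 2 - 16 * j ^ 2) := by linarith
  obtain ⟨c, hc⟩ : i ^ 2 ∣ k ^ 2 - 16 * j ^ 2 :=
    (hil.pow (m := 2) (n := 2)).dvd_of_dvd_mul_left (Dvd.intro _ key)
  have hc' : j ^ 2 - k ^ 2 = l ^ 2 * c := by
    apply mul_left_cancel₀ (pow_ne_zero 2 hi0)
    rw [key, hc]; ring
  have hj15 : c * (i ^ 2 + l ^ 2) = -15 * j ^ 2 := by linarith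
  have hk15 : c * (i ^ 2 + 16 * l ^ 2) = -15 * k ^ 2 := by linarith
  have hc15 : c ∣ 15 := by
    obtain ⟨x, y, hxy⟩ := hjk.pow (m := 2) (n := 2)
    refine ⟨-(x * (i ^ 2 + l ^ 2) + y * (i ^ 2 + 16 * l ^ 2)), ?_⟩
    linear_combination (-15) * hxy + x * hj15 + y * hk15
  have hcneg : c < 0 := by
    have h1 : 0 < j ^ 2 := by positivity
    have h2 : 0 < i ^ 2 + l ^ 2 := by positivity
    by_contra! h
    nlinarith [mul_nonneg h h2.le]
  have hclow : -15 ≤ c := by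
    have := Int.le_of_dvd (by norm_num) ((neg_dvd (a := c)).mpr hc15)
    linarith
  obtain ⟨p, hp⟩ := exists_sq_eq_eight_mul_add_one hi
  obtain ⟨q, hq⟩ := exists_sq_eq_eight_mul_add_one hk
  obtain rfl : c = -15 := by
    have h8 : (8 : ℤ) ∣ c - 1 := ⟨q - 2 * j ^ 2 - p * c, by rw [hp, hq] at hc; linarith⟩
    interval_cases c <;> first | rfl | (exfalso; revert h8 hc15; decide)
  exact ⟨i, j, k, l, Dvd.intro_left _ rfl, hl0, hil, hi, by linarith, by linarith⟩

/-- The forms `X² + Y²` and `X² + 16 Y²` are discordant: they are simultaneously squares, with `X`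
odd and coprime to `Y`, only if `Y = 0`. -/
theorem eq_zero_of_concordant_one_sixteen (X Y Z W : ℤ) (hXY : IsCoprime X Y) (hX : X % 2 = 1)
    (hZ : X ^ 2 + Y ^ 2 = Z ^ 2) (hW : X ^ 2 + 16 * Y ^ 2 = W ^ 2) : Y = 0 := by
  induction hN : Y.natAbs using Nat.strong_induction_on generalizing X Y Z W with
  | _ N ih =>
  by_contra hY
  have hX0 : X ≠ 0 := by rintro rfl; simp at hX
  have hZ0 : Z ≠ 0 := by
    rintro rfl
    have : 0 < X ^ 2 := by positivity
    nlinarith [sq_nonneg Y]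
  have hW0 : W ≠ 0 := by
    rintro rfl
    have : 0 < X ^ 2 := by positivity
    nlinarith [sq_nonneg Y]
  have hX4 : IsCoprime X (4 * Y) := by
    refine IsCoprime.mul_right ?_ hXY
    have h2 : IsCoprime X 2 := ⟨1, -(X / 2), by omega⟩
    simpa using h2.mul_right h2
  have hT : PythagoreanTriple X Y |Z| := by
    unfold PythagoreanTriple; rw [abs_mul_abs_self]; linarith
  have hT' : PythagoreanTriple X (4 * Y) |W| := by
    unfold PythagoreanTriple; rw [abs_mul_abs_self]; linarith
  obtain ⟨m, n, hXm, hYm, -, hmn, -, -⟩ :=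
    hT.coprime_classification' (Int.isCoprime_iff_gcd_eq_one.mp hXY) hX (abs_pos.mpr hZ0)
  obtain ⟨u, v, hXu, hYu, -, huv, hpar, -⟩ :=
    hT'.coprime_classification' (Int.isCoprime_iff_gcd_eq_one.mp hX4) hX (abs_pos.mpr hW0)
  rw [← Int.isCoprime_iff_gcd_eq_one] at hmn huv
  have hm0 : m ≠ 0 := by rintro rfl; simp at hYm; exact hY hYm
  have hn0 : n ≠ 0 := by rintro rfl; simp at hYm; exact hY hYm
  have huv4 : u * v = 4 * (m * n) := by linarith
  have odd_coprime_four {a : ℤ} (ha : a % 2 = 1) : IsCoprime 4 a := by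
    have h2 : IsCoprime 2 a := ⟨-(a / 2), 1, by omega⟩
    simpa using h2.mul_left h2
  have step : ∃ i j k l : ℤ, l ∣ m * n ∧ l ≠ 0 ∧ IsCoprime i l ∧ i % 2 = 1 ∧
      i ^ 2 + l ^ 2 = j ^ 2 ∧ i ^ 2 + 16 * l ^ 2 = k ^ 2 := by
    rcases hpar with ⟨-, hv⟩ | ⟨hu, -⟩
    · obtain ⟨u, rfl⟩ := (odd_coprime_four hv).dvd_of_dvd_mul_right (Dvd.intro _ huv4.symm)
      obtain ⟨i, j, k, l, hl, h⟩ := exists_concordant_of_sq_sub_sq_eq (u := v) (v := u)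
        hmn.symm huv.symm hv hn0 hm0 (by linarith) (by linarith)
      exact ⟨i, j, k, l, hl.mul_right n, h⟩
    · obtain ⟨v, rfl⟩ := (odd_coprime_four hu).dvd_of_dvd_mul_left (Dvd.intro _ huv4.symm)
      obtain ⟨i, j, k, l, hl, h⟩ := exists_concordant_of_sq_sub_sq_eq
        hmn huv hu hm0 hn0 (by linarith) (by linarith)
      exact ⟨i, j, k, l, hl.mul_left m, h⟩
  obtain ⟨i, j, k, l, hl, hl0, hil, hi, hj, hk⟩ := step
  refine hl0 (ih l.natAbs ?_ i l j k hil hi hj hk rfl)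
  have hle := Nat.le_of_dvd (Int.natAbs_pos.mpr (mul_ne_zero hm0 hn0)) (Int.natAbs_dvd_natAbs.mpr hl)
  have hpos := Int.natAbs_pos.mpr (mul_ne_zero hm0 hn0)
  rw [mul_assoc] at hYm
  omega

/-- Coprime integers `n, d` with `d ≠ 0` for which `(n² - d²)(n² + 15 d²)` is a square satisfy
`n² = d²`. -/
lemma sq_eq_sq_of_mul_eq_sq {n d q : ℤ} (hd : d ≠ 0) (hnd : IsCoprime n d)
    (h : (n ^ 2 - d ^ 2) * (n ^ 2 + 15 * d ^ 2) = q ^ 2) : n ^ 2 = d ^ 2 := by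
  have hd2 : 0 < d ^ 2 := by positivity
  have hB : 0 < n ^ 2 + 15 * d ^ 2 := by positivity
  have hA : 0 ≤ n ^ 2 - d ^ 2 := by
    by_contra! hneg
    nlinarith [mul_neg_of_neg_of_pos hneg hB, sq_nonneg q]
  have hAd : IsCoprime (n ^ 2 - d ^ 2) (d ^ 2) := by
    have h1 : IsCoprime (n ^ 2) (d ^ 2) := hnd.pow
    obtain ⟨x, y, hxy⟩ := h1
    exact ⟨x, x + y, by linarith⟩
  rcases Int.emod_two_eq (n ^ 2 - d ^ 2) with hev | hodd
  · have hpar : n % 2 = 1 ∧ d % 2 = 1 := by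
      obtain ⟨x, y, hxy⟩ := hnd
      have h1 : (n - d) % 2 = 0 := by
        rcases Int.emod_two_eq n with hn | hn <;> rcases Int.emod_two_eq d with hd | hd <;>
          simp [pow_two, Int.sub_emod, Int.mul_emod, hn, hd] at hev ⊢
      have h2 : n % 2 ≠ 0 := by
        intro hn
        have hn2 : (2 : ℤ) ∣ n := Int.dvd_of_emod_eq_zero hn
        have hd2 : (2 : ℤ) ∣ d := by omega
        have : (2 : ℤ) ∣ 1 := hxy ▸ dvd_add (hn2.mul_left x) (hd2.mul_left y)
        omega
      omega
    obtain ⟨a, ha⟩ := exists_sq_eq_eight_mul_add_one hpar.1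
    obtain ⟨b, hb⟩ := exists_sq_eq_eight_mul_add_one hpar.2
    obtain ⟨U, hU⟩ : ∃ U, n ^ 2 - d ^ 2 = 8 * U := ⟨a - b, by linarith⟩
    have hUd : IsCoprime U (d ^ 2) := by
      rw [hU] at hAd; exact hAd.of_mul_left_right
    have hq : (8 : ℤ) ∣ q := by
      rw [← Int.pow_dvd_pow_iff (n := 2) (by norm_num)]
      exact ⟨U * (U + 2 * d ^ 2), by rw [← h, hU, show n ^ 2 = 8 * U + d ^ 2 by linarith]; ring⟩
    obtain ⟨q, rfl⟩ := hq
    have hUq : U * (U + 2 * d ^ 2) = q ^ 2 := by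
      have : n ^ 2 = 8 * U + d ^ 2 := by linarith
      rw [this] at h
      linarith
    rcases Int.emod_two_eq U with hU2 | hU2
    · obtain ⟨V, rfl⟩ := Int.dvd_of_emod_eq_zero hU2
      have hq2 : (2 : ℤ) ∣ q := by
        rw [← Int.pow_dvd_pow_iff (n := 2) (by norm_num)]
        exact ⟨V * (V + d ^ 2), by rw [← hUq]; ring⟩
      obtain ⟨q, rfl⟩ := hq2
      have hVd : IsCoprime V (d ^ 2) := hUd.of_mul_left_right
      have hV : IsCoprime V (V + d ^ 2) := by
        obtain ⟨x, y, hxy⟩ := hVd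
        exact ⟨x - y, y, by linarith⟩
      obtain ⟨⟨A, rfl⟩, B, hAB⟩ := exists_sq_and_sq_of_mul_eq_sq (c := q) hV (by linarith)
        (by linarith) (by linarith)
      have hA0 := eq_zero_of_concordant_one_sixteen d A B n
        ((IsCoprime.pow_iff two_pos two_pos).mp hVd).symm hpar.2 (by linarith) (by linarith)
      rw [hA0] at hU
      linarith
    · have hco : IsCoprime U (U + 2 * d ^ 2) := by
        have h2 : IsCoprime U 2 := ⟨1, -(U / 2), by omega⟩
        obtain ⟨x, y, hxy⟩ := h2.mul_right hUd
        exact ⟨x - y, y, by linarith⟩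
      obtain ⟨⟨A, hA'⟩, B, hB'⟩ := exists_sq_and_sq_of_mul_eq_sq hco (by linarith)
        (by linarith) hUq
      have hB4 : B ^ 2 % 4 = 0 ∨ B ^ 2 % 4 = 1 := by
        rcases Int.emod_two_eq B with h' | h'
        · left
          obtain ⟨C, rfl⟩ := Int.dvd_of_emod_eq_zero h'
          rw [mul_pow]; omega
        · right
          obtain ⟨C, hC⟩ := exists_sq_eq_eight_mul_add_one h'
          omega
      have hA2 : A % 2 = 1 := by
        rcases Int.emod_two_eq A with h' | h'
        · rw [hA'] at hU2; simp [pow_two, Int.mul_emod, h'] at hU2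
        · exact h'
      obtain ⟨C, hC⟩ := exists_sq_eq_eight_mul_add_one hA2
      omega
  · have hco : IsCoprime (n ^ 2 - d ^ 2) (n ^ 2 + 15 * d ^ 2) := by
      have h2 : IsCoprime (n ^ 2 - d ^ 2) 2 := ⟨1, -((n ^ 2 - d ^ 2) / 2), by omega⟩
      have h16 : IsCoprime (n ^ 2 - d ^ 2) (2 ^ 4) := h2.pow_right
      obtain ⟨x, y, hxy⟩ := h16.mul_right hAd
      exact ⟨x - y, y, by linarith⟩
    obtain ⟨⟨A, hA'⟩, B, hB'⟩ := exists_sq_and_sq_of_mul_eq_sq hco hA hB.le h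
    have hA2 : A % 2 = 1 := by
      rcases Int.emod_two_eq A with h' | h'
      · rw [hA'] at hodd; simp [pow_two, Int.mul_emod, h'] at hodd
      · exact h'
    rw [hA'] at hAd
    exact absurd (eq_zero_of_concordant_one_sixteen A d n B
      ((IsCoprime.pow_iff two_pos two_pos).mp hAd) hA2 (by linarith) (by linarith)) hd

/-- The affine rational points of `Q² = (P² - 1)(P² + 15)` have `P² = 1`. -/
lemma rat_sq_eq_one_of_mul_eq_sq {P Q : ℚ} (h : (P ^ 2 - 1) * (P ^ 2 + 15) = Q ^ 2) :
    P ^ 2 = 1 := by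
  have hden : (P.den : ℚ) ≠ 0 := by exact_mod_cast P.den_nz
  have hP : P * P.den = P.num := Rat.mul_den_eq_num P
  have hs : ((((P.num ^ 2 - (P.den : ℤ) ^ 2) * (P.num ^ 2 + 15 * (P.den : ℤ) ^ 2) : ℤ)) : ℚ)
      = (Q * P.den ^ 2) ^ 2 := by
    push_cast
    rw [← hP]
    linear_combination (P.den : ℚ) ^ 4 * h
  obtain ⟨q, hq⟩ : IsSquare ((P.num ^ 2 - (P.den : ℤ) ^ 2) * (P.num ^ 2 + 15 * (P.den : ℤ) ^ 2)) :=
    Rat.isSquare_intCast_iff.mp ⟨Q * P.den ^ 2, by rw [hs]; ring⟩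
  have key := sq_eq_sq_of_mul_eq_sq (n := P.num) (d := P.den) (q := q)
    (by exact_mod_cast P.den_nz) P.isCoprime_num_den (by rw [hq]; ring)
  have key' : (P.num : ℚ) ^ 2 = (P.den : ℚ) ^ 2 := by exact_mod_cast key
  rw [← hP, mul_pow] at key'
  exact mul_right_cancel₀ (pow_ne_zero 2 hden) (by linarith)

/-- For all rationals `t, l`, if `l² = t⁴ + 2t³ − t² + 2t + 1` then `t = 0` and
`l = 1` or `l = −1`. -/
theorem A4D3_period_two_discriminant_curve (t l : ℚ)
    (h : l ^ 2 = t ^ 4 + 2 * t ^ 3 - t ^ 2 + 2 * t + 1) :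
    t = 0 ∧ (l = 1 ∨ l = -1) := by
  have ht : t = 0 := by
    obtain ⟨g, rfl⟩ : ∃ g, l = 2 * g + (t ^ 2 + t - 1) :=
      ⟨(l - (t ^ 2 + t - 1)) / 2, by ring⟩
    have hg : g * t ^ 2 + (g - 1) * t + g ^ 2 - g = 0 := by linarith
    by_cases hg1 : g = 1
    · subst hg1
      exact pow_eq_zero_iff two_ne_zero |>.mp (by linarith)
    have hz : 1 - g ≠ 0 := sub_ne_zero.mpr (Ne.symm hg1)
    have hY : (2 * g * t + g - 1) ^ 2 = (1 - g) * (4 * g ^ 2 - g + 1) := by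
      linear_combination 4 * g * hg
    have hP : ((2 * g * t + g - 1) / (1 - g)) ^ 2 = (4 * g ^ 2 - g + 1) / (1 - g) := by
      rw [div_pow, hY]; field_simp
    have hone := rat_sq_eq_one_of_mul_eq_sq (P := (2 * g * t + g - 1) / (1 - g))
      (Q := 4 * g * (2 - g) / (1 - g)) (by rw [hP]; field_simp; ring)
    rw [hP, div_eq_one_iff_eq hz] at hone
    have hg0 : g = 0 := pow_eq_zero_iff two_ne_zero |>.mp (by linarith)
    subst hg0
    linarith
  subst ht
  exact ⟨rfl, sq_eq_one_iff.mp (by linarith)⟩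
end

section
/- Let K be a field of characteristic zero and let a, b ∈ K with a ≠ 0 and b ≠ 0. If b·(a² − 6a + 9) = a·(b² − 6b + 9), b²·(−6a³ + 21a² − 36a + 27) = a²·(−6b³ + 21b² − 36b + 27), b³·(12a⁴ − 44a³ + 63a² − 54a + 27) = a³·(12b⁴ − 44b³ + 63b² − 54b + 27), and b²·(−8a³ + 36a² − 54a + 27) = a²·(−8b³ + 36b² − 54b + 27), then a = b. (These are the cleared-denominator equalities of the fixed-point multiplier invariants σ₁, σ₂, σ₃, σ₄ of f_a(z) = (z³ + a)/(a·z²); hence the parameterization a ↦ [f_a] of A₃(C₃) in the moduli space M₃ is one-to-one.) -/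
/-- Equality of the cleared-denominator fixed-point multiplier invariants of
`f_a(z) = (z³ + a)/(a z²)` forces `a = b`: the parameterization of `A₃(C₃)`
in moduli space is one-to-one. -/
theorem A3C3_parameterization_injective {K : Type*} [Field K] [CharZero K]
    (a b : K) (ha : a ≠ 0) (hb : b ≠ 0)
    (h1 : b * (a ^ 2 - 6 * a + 9) = a * (b ^ 2 - 6 * b + 9))
    (h2 : b ^ 2 * (-6 * a ^ 3 + 21 * a ^ 2 - 36 * a + 27)
        = a ^ 2 * (-6 * b ^ 3 + 21 * b ^ 2 - 36 * b + 27))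
    (h3 : b ^ 3 * (12 * a ^ 4 - 44 * a ^ 3 + 63 * a ^ 2 - 54 * a + 27)
        = a ^ 3 * (12 * b ^ 4 - 44 * b ^ 3 + 63 * b ^ 2 - 54 * b + 27))
    (h4 : b ^ 2 * (-8 * a ^ 3 + 36 * a ^ 2 - 54 * a + 27)
        = a ^ 2 * (-8 * b ^ 3 + 36 * b ^ 2 - 54 * b + 27)) :
    a = b := by
  by_contra hab
  have hsub : a - b ≠ 0 := sub_ne_zero.mpr hab
  have hprod : a * b = 9 := mul_left_cancel₀ hsub (by linear_combination h1)
  have hsum : a + b = -6 := by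
    have h27 : (27 : K) ≠ 0 := by norm_num
    refine mul_left_cancel₀ (mul_ne_zero h27 hsub) ?_
    linear_combination -h2 + (a - b) * (-6 * (a * b + 9) + 36) * hprod
  refine hsub (pow_eq_zero_iff two_ne_zero |>.mp ?_)
  linear_combination (a + b - 6) * hsum - 4 * hprod
end

section
/- Let K be a field of characteristic zero and let k₁, k₂ ∈ K with k₁ ≠ 0 and k₂ ≠ 0. If k₂·(k₁² − 12k₁ + 16) = k₁·(k₂² − 12k₂ + 16), k₂²·(−12k₁³ + 70k₁² − 144k₁ + 96) = k₁²·(−12k₂³ + 70k₂² − 144k₂ + 96), k₂³·(54k₁⁴ − 252k₁³ + 528k₁² − 576k₁ + 256) = k₁³·(54k₂⁴ − 252k₂³ + 528k₂² − 576k₂ + 256), and k₂⁴·(−108k₁⁵ + 513k₁⁴ − 1008k₁³ + 1120k₁² − 768k₁ + 256) = k₁⁴·(−108k₂⁵ + 513k₂⁴ − 1008k₂³ + 1120k₂² − 768k₂ + 256), then k₁ = k₂. (These are the cleared-denominator equalities of the fixed-point multiplier invariants of f_k(z) = (z⁴ + 1)/(k·z³); hence the parameterization k ↦ [f_k] of A₄(C₄)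 in the moduli space M₄ is one-to-one.) -/
/-- Equality of the cleared-denominator fixed-point multiplier invariants of
`f_k(z) = (z⁴ + 1)/(k z³)` forces `k₁ = k₂`: the parameterization of `A₄(C₄)`
in moduli space is one-to-one. -/
theorem A4C4_parameterization_injective {K : Type*} [Field K] [CharZero K]
    (k₁ k₂ : K) (h₁ : k₁ ≠ 0) (h₂ : k₂ ≠ 0)
    (e1 : k₂ * (k₁ ^ 2 - 12 * k₁ + 16) = k₁ * (k₂ ^ 2 - 12 * k₂ + 16))
    (e2 : k₂ ^ 2 * (-12 * k₁ ^ 3 + 70 * k₁ ^ 2 - 144 * k₁ + 96)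
        = k₁ ^ 2 * (-12 * k₂ ^ 3 + 70 * k₂ ^ 2 - 144 * k₂ + 96))
    (e3 : k₂ ^ 3 * (54 * k₁ ^ 4 - 252 * k₁ ^ 3 + 528 * k₁ ^ 2 - 576 * k₁ + 256)
        = k₁ ^ 3 * (54 * k₂ ^ 4 - 252 * k₂ ^ 3 + 528 * k₂ ^ 2 - 576 * k₂ + 256))
    (e4 : k₂ ^ 4 * (-108 * k₁ ^ 5 + 513 * k₁ ^ 4 - 1008 * k₁ ^ 3 + 1120 * k₁ ^ 2
            - 768 * k₁ + 256)
        = k₁ ^ 4 * (-108 * k₂ ^ 5 + 513 * k₂ ^ 4 - 1008 * k₂ ^ 3 + 1120 * k₂ ^ 2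
            - 768 * k₂ + 256)) :
    k₁ = k₂ := by
  by_contra hne
  have hd : k₁ - k₂ ≠ 0 := sub_ne_zero.mpr hne
  have hp : k₁ * k₂ - 16 = 0 := by
    apply mul_left_cancel₀ hd
    linear_combination e1
  have hs : k₁ + k₂ + 8 = 0 := by
    apply mul_left_cancel₀ (mul_ne_zero (show (-96 : K) ≠ 0 by norm_num) hd)
    linear_combination e2 + (k₁ - k₂) * (12 * (k₁ * k₂) + 48) * hp
  apply pow_ne_zero 2 hd
  linear_combination (k₁ + k₂ - 8) * hs - 4 * hp
end
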